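/- The translations sound and strcmplt (where strcmplt f = ⊗L*⁻¹(cmplt f)) witness a one-to-one correspondence between cut-free sequent derivations of S ∣ Γ ⟶ C considered up to ◦≐ and categorical derivations of ⟦S ∣ Γ⟧ ⟶ C considered up to ≐: sound(strcmplt f) ≐ f for every categorical derivation f : ⟦S ∣ Γ⟧ ⟶ C, and strcmplt(sound f) ◦≐ f for every cut-free sequent derivation f of S ∣ Γ ⟶ C. As a special case, sequent derivations of A ∣ – ⟶ C up to ◦≐ correspond bijectively to maps A ⟶ C in the free skew monoidal category Fsk(Var). -/

import Mathlib

set_option linter.unusedVariables false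
inductive Fma (V : Type) : Type
  | var : V → Fma V
  | unit : Fma V
  | tens : Fma V → Fma V → Fma V

abbrev Stp (V : Type) := Option (Fma V)

def stpF {V : Type} : Stp V → Fma V
  | none => Fma.unit
  | some A => A

def semF {V : Type} : Fma V → List (Fma V) → Fma V
  | A, [] => A
  | A, B :: Γ => semF (A.tens B) Γ

abbrev sem {V : Type} (S : Stp V) (Γ : List (Fma V)) : Fma V := semF (stpF S) Γ

theorem semF_append {V : Type} (A : Fma V) (Γ Δ : List (Fma V)) :
    semF A (Γ ++ Δ) = semF (semF A Γ) Δ := by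
  induction Γ generalizing A with
  | nil => rfl
  | cons B Γ ih => exact ih _

/-- The categorical calculus: derivations A ⟶ C of the free skew monoidal category. -/
inductive Der {V : Type} : Fma V → Fma V → Type
  | id : Der A A
  | comp : Der B C → Der A B → Der A C
  | tens : Der A C → Der B D → Der (Fma.tens A B) (Fma.tens C D)
  | lam : Der (Fma.tens Fma.unit A) A
  | rho : Der A (Fma.tens A Fma.unit)
  | alpha : Der (Fma.tens (Fma.tens A B) C) (Fma.tens A (Fma.tens B C))

/-- The cut-free skew monoidal sequent calculus. -/
inductive CF {V : Type} : Stp V → List (Fma V) → Fma V → Type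
  | ax : CF (some A) [] A
  | uf : CF (some A) Γ C → CF none (A :: Γ) C
  | Il : CF none Γ C → CF (some Fma.unit) Γ C
  | Ir : CF none [] Fma.unit
  | tl : CF (some A) (B :: Γ) C → CF (some (Fma.tens A B)) Γ C
  | tr : CF S Γ A → CF none Δ B → CF S (Γ ++ Δ) (Fma.tens A B)

def actDer {V : Type} {A B : Fma V} (f : Der A B) : (Γ : List (Fma V)) → Der (semF A Γ) (semF B Γ)
  | [] => f
  | C :: Γ => actDer (f.tens Der.id) Γ

def psi {V : Type} (A B : Fma V) : (Γ : List (Fma V)) → Der (semF (Fma.tens A B) Γ) (Fma.tens A (semF B Γ))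
  | [] => Der.id
  | C :: Γ => (psi A (Fma.tens B C) Γ).comp (actDer Der.alpha Γ)

def phiF {V : Type} (A : Fma V) : (Γ : List (Fma V)) → (Δ : List (Fma V)) →
    Der (semF A (Γ ++ Δ)) (Fma.tens (semF A Γ) (semF Fma.unit Δ))
  | [], Δ => (psi A Fma.unit Δ).comp (actDer Der.rho Δ)
  | C :: Γ, Δ => phiF (Fma.tens A C) Γ Δ

def phi {V : Type} (S : Stp V) (Γ Δ : List (Fma V)) :
    Der (sem S (Γ ++ Δ)) (Fma.tens (sem S Γ) (sem none Δ)) := phiF (stpF S) Γ Δ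

inductive DerEq {V : Type} : {A C : Fma V} → Der A C → Der A C → Prop
  | refl : DerEq f f
  | symm : DerEq f g → DerEq g f
  | trans : DerEq f g → DerEq g h → DerEq f h
  | compCong : DerEq g g' → DerEq f f' → DerEq (Der.comp g f) (Der.comp g' f')
  | tensCong : DerEq f f' → DerEq g g' → DerEq (Der.tens f g) (Der.tens f' g')
  | compIdL : DerEq (Der.comp Der.id f) f
  | compIdR : DerEq (Der.comp f Der.id) f
  | compAssoc : DerEq (Der.comp h (Der.comp g f)) (Der.comp (Der.comp h g) f)
  | tensId : DerEq (Der.tens (Der.id (A := A)) (Der.id (A := B))) Der.id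
  | tensComp : DerEq (Der.tens (Der.comp g f) (Der.comp k h))
      (Der.comp (Der.tens g k) (Der.tens f h))
  | natLam : DerEq (Der.comp f Der.lam) (Der.comp Der.lam (Der.tens Der.id f))
  | natRho : DerEq (Der.comp Der.rho f) (Der.comp (Der.tens f Der.id) Der.rho)
  | natAlpha : DerEq (Der.comp Der.alpha (Der.tens (Der.tens f g) h))
      (Der.comp (Der.tens f (Der.tens g h)) Der.alpha)
  | lamRho : DerEq (Der.comp Der.lam Der.rho) (Der.id (A := Fma.unit))
  | skewB : DerEq (Der.comp (Der.tens Der.id Der.lam) (Der.comp Der.alpha (Der.tens Der.rho Der.id)))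
      (Der.id (A := Fma.tens A B))
  | skewC : DerEq (Der.comp Der.lam Der.alpha) (Der.tens Der.lam (Der.id (A := B)))
  | skewD : DerEq (Der.comp Der.alpha Der.rho) (Der.tens (Der.id (A := A)) Der.rho)
  | skewE : DerEq
      (Der.comp (Der.tens Der.id Der.alpha) (Der.comp Der.alpha (Der.tens Der.alpha (Der.id (A := D)))))
      (Der.comp Der.alpha Der.alpha)

inductive CFEq {V : Type} : {S : Stp V} → {Γ : List (Fma V)} → {C : Fma V} → CF S Γ C → CF S Γ C → Prop
  | refl : CFEq f f
  | symm : CFEq f g → CFEq g f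
  | trans : CFEq f g → CFEq g h → CFEq f h
  | ufCong : CFEq f g → CFEq (CF.uf f) (CF.uf g)
  | IlCong : CFEq f g → CFEq (CF.Il f) (CF.Il g)
  | tlCong : CFEq f g → CFEq (CF.tl f) (CF.tl g)
  | trCong : CFEq f f' → CFEq g g' → CFEq (CF.tr f g) (CF.tr f' g')
  | axI : CFEq (CF.ax (A := Fma.unit (V := V))) (CF.Il CF.Ir)
  | axTens : CFEq (CF.ax (A := Fma.tens A B)) (CF.tl (CF.tr CF.ax (CF.uf CF.ax)))
  | trUf : CFEq (CF.tr (CF.uf f) g) (CF.uf (CF.tr f g))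
  | trIl : CFEq (CF.tr (CF.Il f) g) (CF.Il (CF.tr f g))
  | trTl : CFEq (CF.tr (CF.tl f) g) (CF.tl (CF.tr f g))

def soundCF {V : Type} {S : Stp V} {Γ : List (Fma V)} {C : Fma V} : CF S Γ C → Der (sem S Γ) C
  | .ax => .id
  | .uf f => (soundCF f).comp (actDer Der.lam _)
  | .Il f => soundCF (S := none) f
  | .Ir => .id
  | .tl (A := A) (B := B) f => soundCF (S := some A) (Γ := B :: _) f
  | .tr f g => ((soundCF f).tens (soundCF g)).comp (phi _ _ _)

def ILinv {V : Type} {Γ : List (Fma V)} {C : Fma V} : CF (some Fma.unit) Γ C → CF none Γ C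
  | .ax => .Ir
  | .Il f => f
  | .tr f g => .tr (ILinv f) g

def tensLinv {V : Type} {Γ : List (Fma V)} {A B C : Fma V} :
    CF (some (Fma.tens A B)) Γ C → CF (some A) (B :: Γ) C
  | .ax => .tr .ax (.uf .ax)
  | .tl f => f
  | .tr f g => .tr (tensLinv f) g

def otLstarF {V : Type} {A : Fma V} {Δ : List (Fma V)} {C : Fma V} :
    (Γ : List (Fma V)) → CF (some A) (Γ ++ Δ) C → CF (some (semF A Γ)) Δ C
  | [], f => f
  | B :: Γ', f => otLstarF Γ' (.tl f)

def otLinvF {V : Type} {A : Fma V} {Δ : List (Fma V)} {C : Fma V} :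
    (Γ : List (Fma V)) → CF (some (semF A Γ)) Δ C → CF (some A) (Γ ++ Δ) C
  | [], f => f
  | B :: Γ', f => tensLinv (otLinvF Γ' f)

def otLstar {V : Type} (S : Stp V) (Γ : List (Fma V)) {Δ : List (Fma V)} {C : Fma V}
    (f : CF S (Γ ++ Δ) C) : CF (some (sem S Γ)) Δ C :=
  match S, f with
  | some _, f => otLstarF Γ f
  | none, f => otLstarF Γ (.Il f)

def otLinvstar {V : Type} (S : Stp V) (Γ : List (Fma V)) {Δ : List (Fma V)} {C : Fma V}
    (f : CF (some (sem S Γ)) Δ C) : CF S (Γ ++ Δ) C :=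
  match S, f with
  | some _, f => otLinvF Γ f
  | none, f => ILinv (otLinvF Γ f)

def splitList {α : Type} :
    (Λ₁ Λ₂ Δ₀ Δ₁ : List α) → (A : α) → Λ₁ ++ Λ₂ = Δ₀ ++ A :: Δ₁ →
      (Σ' Δ₁' : List α, (Λ₁ = Δ₀ ++ A :: Δ₁') ×' (Δ₁ = Δ₁' ++ Λ₂)) ⊕
      (Σ' Δ₀' : List α, (Λ₂ = Δ₀' ++ A :: Δ₁) ×' (Δ₀ = Λ₁ ++ Δ₀'))
  | [], Λ₂, Δ₀, Δ₁, A, h => .inr ⟨Δ₀, h, rfl⟩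
  | X :: Λ₁', Λ₂, [], Δ₁, A, h => by
      simp only [List.cons_append, List.nil_append] at h
      injection h with h1 h2
      subst h1
      exact .inl ⟨Λ₁', rfl, h2.symm⟩
  | X :: Λ₁', Λ₂, Y :: Δ₀', Δ₁, A, h => by
      simp only [List.cons_append] at h
      injection h with h1 h2
      subst h1
      rcases splitList Λ₁' Λ₂ Δ₀' Δ₁ A h2 with ⟨Δ₁', e1, e2⟩ | ⟨Δ₀'', e1, e2⟩
      · exact .inl ⟨Δ₁', by rw [e1]; simp, e2⟩
      · exact .inr ⟨Δ₀'', e1, by rw [e2]; simp⟩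

mutual
def scutCF : {V : Type} → {S : Stp V} → {Γ Δ : List (Fma V)} → {A C : Fma V} →
    CF S Γ A → CF (some A) Δ C → CF S (Γ ++ Δ) C
  | _, _, _, _, _, _, .ax, g => g
  | _, _, _, _, _, _, .uf f, g => .uf (scutCF f g)
  | _, _, _, _, _, _, .Il f, g => .Il (scutCF f g)
  | _, _, _, _, _, _, .tl f, g => .tl (scutCF f g)
  | _, _, _, _, _, _, .Ir, .ax => .Ir
  | _, _, _, _, _, _, .Ir, .Il g => g
  | _, _, _, _, _, _, .Ir, .tr g1 g2 => by
      simp only [List.nil_append]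
      exact .tr (scutCF .Ir g1) g2
  | _, _, _, _, _, _, .tr f1 f2, .ax => by
      rw [List.append_nil]; exact .tr f1 f2
  | _, _, _, _, _, _, .tr (Γ := Γ₁) f1 f2, .tl g => ccutCF Γ₁ f2 (scutCF f1 g) rfl
  | _, _, _, _, _, _, .tr f1 f2, .tr g1 g2 => by
      rw [← List.append_assoc]
      exact .tr (scutCF (.tr f1 f2) g1) g2
  termination_by V S Γ Δ A C f g => (sizeOf A, sizeOf g, sizeOf f)
  decreasing_by
    all_goals subst_vars
    all_goals simp_wf
    all_goals (first
      | (apply Prod.Lex.left; first | omega | (simp; omega))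
      | (apply Prod.Lex.right; first
          | (apply Prod.Lex.left; first | omega | (simp; omega))
          | (apply Prod.Lex.right; first | omega | (simp; omega))))

def ccutCF : {V : Type} → {S : Stp V} → {Γ Λ Δ₁ : List (Fma V)} → {A C : Fma V} →
    (Δ₀ : List (Fma V)) → CF none Γ A → (g : CF S Λ C) → Λ = Δ₀ ++ A :: Δ₁ →
    CF S ((Δ₀ ++ Γ) ++ Δ₁) C
  | _, _, _, _, _, _, _, _, _, .ax, h => by simp at h
  | _, _, _, _, _, _, _, _, _, .Ir, h => by simp at h
  | _, _, _, _, _, _, _, [], f, .uf g, h => by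
      simp only [List.nil_append] at h
      injection h with h1 h2
      subst h1; subst h2
      exact scutCF f g
  | _, _, _, _, _, _, _, A'' :: Δ₀', f, .uf g, h => by
      simp only [List.cons_append] at h
      injection h with h1 h2
      subst h1
      exact .uf (ccutCF Δ₀' f g h2)
  | _, _, _, _, _, _, _, Δ₀, f, .Il g, h => .Il (ccutCF Δ₀ f g h)
  | _, _, _, _, _, _, _, Δ₀, f, .tl (B := B) g, h => .tl (ccutCF (B :: Δ₀) f g (by simp [h]))
  | _, _, _, _, Δ₁, _, _, Δ₀, f, .tr (Γ := Λ₁) (Δ := Λ₂) g1 g2, h => by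
      rcases splitList Λ₁ Λ₂ Δ₀ _ _ h with ⟨Δ₁', h1, h2⟩ | ⟨Δ₀', h1, h2⟩
      · subst h2
        have e : ∀ Γ' : List _, (Δ₀ ++ Γ') ++ (Δ₁' ++ Λ₂) = ((Δ₀ ++ Γ') ++ Δ₁') ++ Λ₂ := by
          intro Γ'; simp
        rw [e]
        exact .tr (ccutCF Δ₀ f g1 h1) g2
      · subst h2
        have e : ∀ Γ' : List _, ((Λ₁ ++ Δ₀') ++ Γ') ++ Δ₁ = Λ₁ ++ ((Δ₀' ++ Γ') ++ Δ₁) := by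
          intro Γ'; simp
        rw [e]
        exact .tr g1 (ccutCF Δ₀' f g2 h1)
  termination_by V S Γ Λ Δ₁ A C Δ₀ f g h => (sizeOf A, sizeOf g, sizeOf f)
  decreasing_by
    all_goals subst_vars
    all_goals simp_wf
    all_goals (first
      | (apply Prod.Lex.left; first | omega | (simp; omega))
      | (apply Prod.Lex.right; first
          | (apply Prod.Lex.left; first | omega | (simp; omega))
          | (apply Prod.Lex.right; first | omega | (simp; omega))))
end

def cmpltCF {V : Type} {A C : Fma V} : Der A C → CF (some A) [] C
  | .id => .ax
  | .comp g f => scutCF (Γ := []) (Δ := []) (cmpltCF f) (cmpltCF g)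
  | .tens f g => .tl (.tr (cmpltCF f) (.uf (cmpltCF g)))
  | .lam => .tl (.Il (.uf .ax))
  | .rho => .tr .ax .Ir
  | .alpha => .tl (.tl (.tr .ax (.uf (.tr .ax (.uf .ax)))))

def strcmplt {V : Type} {S : Stp V} {Γ : List (Fma V)} {C : Fma V}
    (f : Der (sem S Γ) C) : CF S Γ C := by
  have h := otLinvstar S Γ (Δ := []) (cmpltCF f)
  rwa [List.append_nil] at h

section

open CategoryTheory

namespace Fma

variable {V : Type}

/-- The number of leaves of a formula. -/
def leaves : Fma V → ℕ
  | var _ => 1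
  | unit => 1
  | tens A B => leaves A + leaves B

theorem leaves_pos (A : Fma V) : 0 < A.leaves := by
  induction A with
  | var _ => simp [leaves]
  | unit => simp [leaves]
  | tens A B ihA ihB => simp only [leaves]; omega

end Fma

variable {V : Type}

theorem leaves_semF (A : Fma V) (Γ : List (Fma V)) :
    (semF A Γ).leaves = A.leaves + (Γ.map Fma.leaves).sum := by
  induction Γ generalizing A with
  | nil => simp [semF]
  | cons B Γ ih => simp [semF, ih, Fma.leaves, add_assoc]

namespace Der

/-- The monotone map on leaves induced by a categorical derivation `A ⟶ C`, extended beyond the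
last leaf of `A` by a shift. -/
def leafMap : {A C : Fma V} → Der A C → ℕ → ℕ
  | _, _, .id => fun i => i
  | _, _, .comp g f => fun i => leafMap g (leafMap f i)
  | _, _, .tens (A := A) (C := C) f g => fun i =>
      if i < A.leaves then leafMap f i else leafMap g (i - A.leaves) + C.leaves
  | _, _, .lam => fun i => i - 1
  | _, _, .rho (A := A) => fun i => if i < A.leaves then i else i + 1
  | _, _, .alpha => fun i => i

theorem leafMap_bounds {A C : Fma V} (f : Der A C) (i : ℕ) :
    (i < A.leaves → f.leafMap i < C.leaves) ∧
      (A.leaves ≤ i → f.leafMap i = i - A.leaves + C.leaves) := by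
  induction f generalizing i with
  | id => simp only [leafMap]; omega
  | comp g f ihg ihf =>
    have h1 := ihf i
    have h2 := ihg (f.leafMap i)
    simp only [leafMap]
    omega
  | @tens A C B D f g ihf ihg =>
    have h1 := ihf i
    have h2 := ihg (i - A.leaves)
    simp only [leafMap, Fma.leaves]
    split_ifs <;> omega
  | @lam A => have := A.leaves_pos; simp only [leafMap, Fma.leaves]; omega
  | rho => simp only [leafMap, Fma.leaves]; split_ifs <;> omega
  | alpha => simp only [leafMap, Fma.leaves]; omega

theorem leafMap_lt {A C : Fma V} (f : Der A C) {i : ℕ} (h : i < A.leaves) :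
    f.leafMap i < C.leaves := (f.leafMap_bounds i).1 h

theorem leafMap_of_le {A C : Fma V} (f : Der A C) {i : ℕ} (h : A.leaves ≤ i) :
    f.leafMap i = i - A.leaves + C.leaves := (f.leafMap_bounds i).2 h

theorem leafMap_zero {A C : Fma V} (f : Der A C) : f.leafMap 0 = 0 := by
  induction f with
  | id => rfl
  | comp g f ihg ihf => simp [leafMap, ihf, ihg]
  | @tens A C B D f g ihf ihg => simp [leafMap, ihf, A.leaves_pos]
  | lam => rfl
  | @rho A => simp [leafMap, A.leaves_pos]
  | alpha => rfl

theorem leafMap_tens_id {A C : Fma V} (f : Der A C) (B : Fma V) :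
    (f.tens (id (A := B))).leafMap = f.leafMap := by
  funext i
  simp only [leafMap]
  split_ifs with h
  · rfl
  · rw [f.leafMap_of_le (by omega)]

theorem leafMap_actDer {A C : Fma V} (f : Der A C) (Γ : List (Fma V)) :
    (actDer f Γ).leafMap = f.leafMap := by
  induction Γ generalizing A C with
  | nil => rfl
  | cons B Γ ih => simp only [actDer]; exact (ih (f.tens id)).trans (leafMap_tens_id f B)

theorem leafMap_psi (A B : Fma V) (Γ : List (Fma V)) : (psi A B Γ).leafMap = fun i => i := by
  induction Γ generalizing B with
  | nil => rfl
  | cons C Γ ih =>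
    funext i
    exact (congrFun (ih (B.tens C)) _).trans (congrFun (leafMap_actDer alpha Γ) i)

theorem leafMap_phiF (A : Fma V) (Γ Δ : List (Fma V)) :
    (phiF A Γ Δ).leafMap = fun i => if i < (semF A Γ).leaves then i else i + 1 := by
  induction Γ generalizing A with
  | nil =>
    funext i
    exact (congrFun (leafMap_psi A Fma.unit Δ) _).trans (congrFun (leafMap_actDer rho Δ) i)
  | cons C Γ ih => exact ih _

end Der

theorem DerEq.leafMap_eq {A C : Fma V} {f g : Der A C} (h : DerEq f g) :
    f.leafMap = g.leafMap := by
  induction h with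
  | refl => rfl
  | symm _ ih => exact ih.symm
  | trans _ _ ih1 ih2 => exact ih1.trans ih2
  | compCong _ _ ih1 ih2 => simp only [Der.leafMap, ih1, ih2]
  | tensCong _ _ ih1 ih2 => simp only [Der.leafMap, ih1, ih2]
  | compIdL => rfl
  | compIdR => rfl
  | compAssoc => rfl
  | tensId => exact Der.leafMap_tens_id _ _
  | @tensComp B C g A f _ _ k _ h =>
    funext i
    have h1 := f.leafMap_bounds i
    simp only [Der.leafMap]
    grind
  | @natLam A B f =>
    funext i
    have h0 := f.leafMap_zero
    simp only [Der.leafMap, Fma.leaves]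
    grind
  | @natRho A B f =>
    funext i
    have h1 := f.leafMap_bounds i
    simp only [Der.leafMap]
    grind
  | @natAlpha A A' f B B' g C C' h =>
    funext i
    have h1 := f.leafMap_bounds i
    have h2 := g.leafMap_bounds (i - A.leaves)
    simp only [Der.leafMap, Fma.leaves, Nat.sub_sub]
    grind
  | lamRho =>
    funext i
    simp only [Der.leafMap, Fma.leaves]
    grind
  | @skewB A B =>
    funext i
    simp only [Der.leafMap, Fma.leaves]
    grind
  | skewC =>
    funext i
    simp only [Der.leafMap, Fma.leaves]
    grind
  | skewD =>
    funext i
    simp only [Der.leafMap, Fma.leaves]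
    grind
  | skewE =>
    funext i
    simp only [Der.leafMap, Fma.leaves]
    grind

/-! ### The free skew monoidal category -/

instance derSetoid (A C : Fma V) : Setoid (Der A C) where
  r := DerEq
  iseqv := ⟨fun _ => .refl, .symm, .trans⟩

instance fskCategory : Category (Fma V) where
  Hom A C := Quotient (derSetoid A C)
  id A := ⟦Der.id⟧
  comp := Quotient.map₂ (fun f g => g.comp f) fun _ _ hf _ _ hg => .compCong hg hf
  id_comp := by rintro _ _ ⟨f⟩; exact Quotient.sound .compIdR
  comp_id := by rintro _ _ ⟨f⟩; exact Quotient.sound .compIdL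
  assoc := by rintro _ _ _ _ ⟨f⟩ ⟨g⟩ ⟨h⟩; exact Quotient.sound .compAssoc

namespace Fsk

/-- The map of `Fsk` represented by a categorical derivation. -/
def cls {A C : Fma V} (f : Der A C) : A ⟶ C := Quotient.mk (derSetoid A C) f

theorem cls_surjective {A C : Fma V} (f : A ⟶ C) : ∃ g, cls g = f := Quotient.exists_rep f

theorem cls_eq_iff {A C : Fma V} {f g : Der A C} : cls f = cls g ↔ DerEq f g :=
  Quotient.eq (r := derSetoid A C)

/-- The action of the tensor product on maps. -/
def tensHom {A B C D : Fma V} : (A ⟶ C) → (B ⟶ D) → (A.tens B ⟶ C.tens D) :=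
  Quotient.map₂ Der.tens fun _ _ hf _ _ hg => .tensCong hf hg

local infixr:81 " ⊠ " => tensHom

/-- The left unitor. -/
def lam (A : Fma V) : Fma.unit.tens A ⟶ A := cls Der.lam

/-- The right unitor. -/
def rho (A : Fma V) : A ⟶ A.tens Fma.unit := cls Der.rho

/-- The associator. -/
def alpha (A B C : Fma V) : (A.tens B).tens C ⟶ A.tens (B.tens C) := cls Der.alpha

theorem cls_tens {A B C D : Fma V} (f : Der A C) (g : Der B D) :
    cls (f.tens g) = cls f ⊠ cls g := rfl

@[simp]
theorem tens_id (A B : Fma V) : 𝟙 A ⊠ 𝟙 B = 𝟙 (A.tens B) := Quotient.sound .tensId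

theorem tens_comp {A A' A'' B B' B'' : Fma V} (f : A ⟶ A') (g : A' ⟶ A'') (h : B ⟶ B')
    (k : B' ⟶ B'') : (f ≫ g) ⊠ (h ≫ k) = f ⊠ h ≫ g ⊠ k := by
  obtain ⟨f, rfl⟩ := cls_surjective f
  obtain ⟨g, rfl⟩ := cls_surjective g
  obtain ⟨h, rfl⟩ := cls_surjective h
  obtain ⟨k, rfl⟩ := cls_surjective k
  exact Quotient.sound .tensComp

theorem tens_comp_id {A A' A'' : Fma V} (f : A ⟶ A') (g : A' ⟶ A'') (B : Fma V) :
    (f ≫ g) ⊠ 𝟙 B = f ⊠ 𝟙 B ≫ g ⊠ 𝟙 B := by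
  rw [← tens_comp, Category.comp_id]

theorem id_tens_comp {A A' A'' : Fma V} (B : Fma V) (f : A ⟶ A') (g : A' ⟶ A'') :
    𝟙 B ⊠ (f ≫ g) = 𝟙 B ⊠ f ≫ 𝟙 B ⊠ g := by
  rw [← tens_comp, Category.comp_id]

theorem tens_exchange {A A' B B' : Fma V} (f : A ⟶ A') (g : B ⟶ B') :
    f ⊠ 𝟙 B ≫ 𝟙 A' ⊠ g = f ⊠ g := by
  rw [← tens_comp, Category.comp_id, Category.id_comp]

theorem tens_exchange' {A A' B B' : Fma V} (f : A ⟶ A') (g : B ⟶ B') :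
    𝟙 A ⊠ g ≫ f ⊠ 𝟙 B' = f ⊠ g := by
  rw [← tens_comp, Category.comp_id, Category.id_comp]

theorem lam_naturality {A B : Fma V} (f : A ⟶ B) : lam A ≫ f = 𝟙 _ ⊠ f ≫ lam B := by
  obtain ⟨f, rfl⟩ := cls_surjective f
  exact Quotient.sound .natLam

theorem rho_naturality {A B : Fma V} (f : A ⟶ B) : f ≫ rho B = rho A ≫ f ⊠ 𝟙 _ := by
  obtain ⟨f, rfl⟩ := cls_surjective f
  exact Quotient.sound .natRho

theorem alpha_naturality {A A' B B' C C' : Fma V} (f : A ⟶ A') (g : B ⟶ B') (h : C ⟶ C') :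
    (f ⊠ g) ⊠ h ≫ alpha A' B' C' = alpha A B C ≫ f ⊠ g ⊠ h := by
  obtain ⟨f, rfl⟩ := cls_surjective f
  obtain ⟨g, rfl⟩ := cls_surjective g
  obtain ⟨h, rfl⟩ := cls_surjective h
  exact Quotient.sound .natAlpha

theorem rho_lam : rho Fma.unit ≫ lam Fma.unit = 𝟙 (Fma.unit : Fma V) := Quotient.sound .lamRho

theorem rho_alpha_lam (A B : Fma V) :
    rho A ⊠ 𝟙 B ≫ alpha A Fma.unit B ≫ 𝟙 A ⊠ lam B = 𝟙 (A.tens B) :=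
  (Category.assoc _ _ _).symm.trans (Quotient.sound .skewB)

theorem alpha_lam (A B : Fma V) : alpha Fma.unit A B ≫ lam (A.tens B) = lam A ⊠ 𝟙 B :=
  Quotient.sound .skewC

theorem rho_alpha (A B : Fma V) : rho (A.tens B) ≫ alpha A B Fma.unit = 𝟙 A ⊠ rho B :=
  Quotient.sound .skewD

theorem pentagon (A B C D : Fma V) :
    alpha A B C ⊠ 𝟙 D ≫ alpha A (B.tens C) D ≫ 𝟙 A ⊠ alpha B C D =
      alpha (A.tens B) C D ≫ alpha A B (C.tens D) :=
  (Category.assoc _ _ _).symm.trans (Quotient.sound .skewE)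

/-- The functorial action of tensoring on the right with a list of formulae. -/
def act {A B : Fma V} (f : A ⟶ B) : (Γ : List (Fma V)) → (semF A Γ ⟶ semF B Γ)
  | [] => f
  | C :: Γ => act (f ⊠ 𝟙 C) Γ

theorem cls_actDer {A B : Fma V} (f : Der A B) (Γ : List (Fma V)) :
    cls (actDer f Γ) = act (cls f) Γ := by
  induction Γ generalizing A B with
  | nil => rfl
  | cons C Γ ih => exact ih _

@[simp]
theorem act_id (A : Fma V) (Γ : List (Fma V)) : act (𝟙 A) Γ = 𝟙 (semF A Γ) := by
  induction Γ generalizing A with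
  | nil => rfl
  | cons C Γ ih => simp only [act, tens_id]; exact ih _

theorem act_comp {A B C : Fma V} (f : A ⟶ B) (g : B ⟶ C) (Γ : List (Fma V)) :
    act (f ≫ g) Γ = act f Γ ≫ act g Γ := by
  induction Γ generalizing A B C with
  | nil => rfl
  | cons D Γ ih => simp only [act, tens_comp_id]; exact ih _ _

theorem act_eqToHom {A B : Fma V} (h : A = B) (Γ : List (Fma V)) :
    act (eqToHom h) Γ = eqToHom (by rw [h]) := by
  subst h
  simp

theorem act_append {A B : Fma V} (f : A ⟶ B) (Γ Δ : List (Fma V)) :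
    act f (Γ ++ Δ) =
      eqToHom (semF_append A Γ Δ) ≫ act (act f Γ) Δ ≫ eqToHom (semF_append B Γ Δ).symm := by
  induction Γ generalizing A B with
  | nil => exact (Category.comp_id (act f Δ)).symm.trans (Category.id_comp _).symm
  | cons D Γ ih => exact ih (f ⊠ 𝟙 D)

/-- The class of `psi`. -/
def psiHom (A B : Fma V) (Γ : List (Fma V)) : semF (A.tens B) Γ ⟶ A.tens (semF B Γ) :=
  cls (psi A B Γ)

theorem psiHom_nil (A B : Fma V) : psiHom A B [] = 𝟙 _ := rfl

theorem psiHom_cons (A B C : Fma V) (Γ : List (Fma V)) :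
    psiHom A B (C :: Γ) = act (alpha A B C) Γ ≫ psiHom A (B.tens C) Γ :=
  congrArg (· ≫ psiHom A (B.tens C) Γ) (cls_actDer Der.alpha Γ)

theorem psiHom_naturality {A A' B B' : Fma V} (f : A ⟶ A') (g : B ⟶ B') (Γ : List (Fma V)) :
    act (f ⊠ g) Γ ≫ psiHom A' B' Γ = psiHom A B Γ ≫ f ⊠ act g Γ := by
  induction Γ generalizing B B' with
  | nil => exact (Category.comp_id _).trans (Category.id_comp _).symm
  | cons C Γ ih =>
    rw [psiHom_cons, psiHom_cons]
    have key : act ((f ⊠ g) ⊠ 𝟙 C) Γ ≫ act (alpha A' B' C) Γ ≫ psiHom A' (B'.tens C) Γ =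
        (act (alpha A B C) Γ ≫ psiHom A (B.tens C) Γ) ≫ f ⊠ act (g ⊠ 𝟙 C) Γ := by
      rw [Category.assoc, ← ih, ← Category.assoc, ← act_comp, alpha_naturality, act_comp,
        Category.assoc]
    exact key

theorem psiHom_append (A B : Fma V) (Γ Δ : List (Fma V)) :
    psiHom A B (Γ ++ Δ) = eqToHom (semF_append _ Γ Δ) ≫ act (psiHom A B Γ) Δ ≫
      psiHom A (semF B Γ) Δ ≫ eqToHom (by rw [semF_append]) := by
  induction Γ generalizing B with
  | nil =>
    have key : psiHom A B Δ = 𝟙 _ ≫ act (𝟙 _) Δ ≫ psiHom A B Δ ≫ 𝟙 _ := by simp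
    exact key
  | cons C Γ ih =>
    rw [psiHom_cons A B C Γ]
    have key : act (alpha A B C) (Γ ++ Δ) ≫ psiHom A (B.tens C) (Γ ++ Δ) =
        eqToHom (semF_append _ Γ Δ) ≫ act (act (alpha A B C) Γ ≫ psiHom A (B.tens C) Γ) Δ ≫
          psiHom A (semF (B.tens C) Γ) Δ ≫ eqToHom (by rw [semF_append]) := by
      rw [ih, act_append, act_comp]
      simp
    exact (psiHom_cons A B C (Γ ++ Δ)).trans key

theorem psiHom_unit_lam (B : Fma V) (Γ : List (Fma V)) :
    psiHom Fma.unit B Γ ≫ lam (semF B Γ) = act (lam B) Γ := by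
  induction Γ generalizing B with
  | nil => exact Category.id_comp _
  | cons C Γ ih =>
    rw [psiHom_cons]
    have key : (act (alpha Fma.unit B C) Γ ≫ psiHom Fma.unit (B.tens C) Γ) ≫
        lam (semF (B.tens C) Γ) = act (lam B ⊠ 𝟙 C) Γ := by
      rw [Category.assoc, ih, ← act_comp, alpha_lam]
    exact key

theorem psiHom_alpha (A B C : Fma V) (Γ : List (Fma V)) :
    psiHom (A.tens B) C Γ ≫ alpha A B (semF C Γ) =
      act (alpha A B C) Γ ≫ psiHom A (B.tens C) Γ ≫ 𝟙 A ⊠ psiHom B C Γ := by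
  induction Γ generalizing C with
  | nil =>
    have key : 𝟙 _ ≫ alpha A B C = alpha A B C ≫ 𝟙 _ ≫ 𝟙 A ⊠ 𝟙 _ := by simp
    exact key
  | cons D Γ ih =>
    simp only [psiHom_cons]
    have key : (act (alpha (A.tens B) C D) Γ ≫ psiHom (A.tens B) (C.tens D) Γ) ≫
        alpha A B (semF (C.tens D) Γ) =
        act (alpha A B C ⊠ 𝟙 D) Γ ≫ (act (alpha A (B.tens C) D) Γ ≫
          psiHom A ((B.tens C).tens D) Γ) ≫
            𝟙 A ⊠ (act (alpha B C D) Γ ≫ psiHom B (C.tens D) Γ) := by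
      rw [id_tens_comp, Category.assoc, Category.assoc, ih, ← Category.assoc (psiHom A _ Γ),
        ← psiHom_naturality]
      simp only [← Category.assoc, ← act_comp]
      rw [← pentagon]
      simp only [Category.assoc]
    exact key

/-- The comparison map splitting off a list of passive formulae. -/
def split (A : Fma V) (Δ : List (Fma V)) : semF A Δ ⟶ A.tens (semF Fma.unit Δ) :=
  act (rho A) Δ ≫ psiHom A Fma.unit Δ

theorem split_naturality {A B : Fma V} (f : A ⟶ B) (Δ : List (Fma V)) :
    act f Δ ≫ split B Δ = split A Δ ≫ f ⊠ 𝟙 _ := by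
  have h := psiHom_naturality f (𝟙 Fma.unit) Δ
  rw [act_id] at h
  rw [split, split, Category.assoc, ← h, ← Category.assoc, ← act_comp, rho_naturality, act_comp,
    Category.assoc]

theorem split_unit_lam (Δ : List (Fma V)) :
    split Fma.unit Δ ≫ lam (semF Fma.unit Δ) = 𝟙 _ := by
  rw [split, Category.assoc, psiHom_unit_lam, ← act_comp, rho_lam, act_id]

theorem split_alpha (A B : Fma V) (Δ : List (Fma V)) :
    split (A.tens B) Δ ≫ alpha A B (semF Fma.unit Δ) = psiHom A B Δ ≫ 𝟙 A ⊠ split B Δ := by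
  rw [split, split, id_tens_comp, Category.assoc, psiHom_alpha, ← Category.assoc (psiHom A B Δ),
    ← psiHom_naturality, ← rho_alpha, act_comp]
  simp only [Category.assoc]

theorem split_append (A : Fma V) (Γ Δ : List (Fma V)) :
    split A (Γ ++ Δ) = eqToHom (semF_append _ Γ Δ) ≫ act (split A Γ) Δ ≫
      psiHom A (semF Fma.unit Γ) Δ ≫ eqToHom (by rw [semF_append]) := by
  rw [split, psiHom_append, act_append, split, act_comp]
  simp

theorem cls_phiF (A : Fma V) (Γ Δ : List (Fma V)) :
    cls (phiF A Γ Δ) = eqToHom (semF_append A Γ Δ) ≫ split (semF A Γ) Δ := by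
  induction Γ generalizing A with
  | nil =>
    exact (congrArg (· ≫ psiHom A Fma.unit Δ) (cls_actDer Der.rho Δ)).trans
      (Category.id_comp _).symm
  | cons C Γ ih => exact ih _

/-- The interpretation of a cut-free derivation in `Fsk`. -/
def sound {S : Stp V} {Γ : List (Fma V)} {C : Fma V} (f : CF S Γ C) : sem S Γ ⟶ C :=
  cls (soundCF f)

theorem sound_uf {A C : Fma V} {Γ : List (Fma V)} (f : CF (some A) Γ C) :
    sound f.uf = act (lam A) Γ ≫ sound f :=
  congrArg (· ≫ sound f) (cls_actDer Der.lam Γ)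

theorem sound_tr {S : Stp V} {Γ Δ : List (Fma V)} {A B : Fma V} (f : CF S Γ A)
    (g : CF none Δ B) : sound (f.tr g) =
      eqToHom (semF_append _ Γ Δ) ≫ split (sem S Γ) Δ ≫ sound f ⊠ sound g :=
  (congrArg (· ≫ sound f ⊠ sound g) (cls_phiF (stpF S) Γ Δ)).trans (Category.assoc _ _ _)

theorem split_act_tens {A B C D : Fma V} {Γ Δ : List (Fma V)} (t : A ⟶ B) (f : semF B Γ ⟶ C)
    (g : semF Fma.unit Δ ⟶ D) :
    eqToHom (semF_append A Γ Δ) ≫ split (semF A Γ) Δ ≫ (act t Γ ≫ f) ⊠ g =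
      act t (Γ ++ Δ) ≫ eqToHom (semF_append B Γ Δ) ≫ split (semF B Γ) Δ ≫ f ⊠ g := by
  rw [← tens_exchange _ g, tens_comp_id, ← tens_exchange f g, act_append]
  simp only [Category.assoc, eqToHom_trans_assoc, eqToHom_refl, Category.id_comp]
  rw [← Category.assoc (split _ _), ← split_naturality]
  simp only [Category.assoc]

theorem sound_tr_uf {A B C : Fma V} {Γ Δ : List (Fma V)} (f : CF (some A) Γ B)
    (g : CF none Δ C) : sound (f.uf.tr g) = sound (f.tr g).uf := by
  rw [sound_tr, sound_uf, sound_uf, sound_tr]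
  exact split_act_tens (lam A) (sound f) (sound g)

theorem split_singleton (A B : Fma V) :
    split A [B] = rho A ⊠ 𝟙 B ≫ alpha A Fma.unit B := by
  rw [split, psiHom_cons, psiHom_nil]
  exact congrArg _ (Category.comp_id _)

theorem sound_axTens (A B : Fma V) :
    sound (CF.ax (A := A.tens B)) = sound (CF.tl (CF.tr CF.ax (CF.uf CF.ax))) := by
  have key : 𝟙 (A.tens B) = 𝟙 _ ≫ (rho A ⊠ 𝟙 B ≫ alpha A Fma.unit B) ≫ 𝟙 A ⊠ lam B := by
    rw [Category.id_comp, Category.assoc, rho_alpha_lam]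
  have h : sound (CF.uf (CF.ax (A := B))) = lam B :=
    (sound_uf _).trans (Category.comp_id (lam B))
  rw [← h, ← split_singleton] at key
  exact key.trans (sound_tr CF.ax (CF.uf CF.ax)).symm

theorem sound_eq_of_cfEq {S : Stp V} {Γ : List (Fma V)} {C : Fma V} {f g : CF S Γ C}
    (h : CFEq f g) : sound f = sound g := by
  induction h with
  | refl => rfl
  | symm _ ih => exact ih.symm
  | trans _ _ ih1 ih2 => exact ih1.trans ih2
  | ufCong _ ih => rw [sound_uf, sound_uf, ih]
  | IlCong _ ih => exact ih
  | tlCong _ ih => exact ih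
  | trCong _ _ ih1 ih2 => rw [sound_tr, sound_tr, ih1, ih2]
  | axI => rfl
  | axTens => exact sound_axTens _ _
  | trUf => exact sound_tr_uf _ _
  | trIl => rfl
  | trTl => rfl

end Fsk

/-! ### Inversion of the left rules -/

theorem cfEq_Il_ILinv {Γ : List (Fma V)} {C : Fma V} :
    ∀ f : CF (some Fma.unit) Γ C, CFEq (CF.Il (ILinv f)) f
  | .ax => .symm .axI
  | .Il _ => by simp only [ILinv]; exact .refl
  | .tr f _ => .trans (.symm .trIl) (.trCong (cfEq_Il_ILinv f) .refl)

theorem cfEq_tl_tensLinv {Γ : List (Fma V)} {A B C : Fma V} :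
    ∀ f : CF (some (A.tens B)) Γ C, CFEq (CF.tl (tensLinv f)) f
  | .ax => .symm .axTens
  | .tl _ => by simp only [tensLinv]; exact .refl
  | .tr f _ => .trans (.symm .trTl) (.trCong (cfEq_tl_tensLinv f) .refl)

namespace Fsk

local infixr:81 " ⊠ " => tensHom

theorem sound_ILinv {Γ : List (Fma V)} {C : Fma V} (f : CF (some Fma.unit) Γ C) :
    sound (ILinv f) = sound f :=
  sound_eq_of_cfEq (cfEq_Il_ILinv f)

theorem sound_tensLinv {Γ : List (Fma V)} {A B C : Fma V} (f : CF (some (A.tens B)) Γ C) :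
    sound (tensLinv f) = sound f :=
  sound_eq_of_cfEq (cfEq_tl_tensLinv f)

/-! ### Every map of `Fsk` is the interpretation of a cut-free derivation -/

/-- Replacing the last passive formula `A` by a list `Θ` along a map `⟦– ∣ Θ⟧ ⟶ A`. -/
def insertHom {A : Fma V} {Θ : List (Fma V)} (t : semF Fma.unit Θ ⟶ A) (X : Fma V) :
    semF X Θ ⟶ X.tens A :=
  split X Θ ≫ 𝟙 X ⊠ t

theorem insertHom_naturality {A X Y : Fma V} {Θ : List (Fma V)} (t : semF Fma.unit Θ ⟶ A)
    (f : X ⟶ Y) : act f Θ ≫ insertHom t Y = insertHom t X ≫ f ⊠ 𝟙 A := by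
  rw [insertHom, insertHom, Category.assoc, tens_exchange', ← Category.assoc, split_naturality,
    Category.assoc, tens_exchange]

theorem insertHom_unit_lam {A : Fma V} {Θ : List (Fma V)} (t : semF Fma.unit Θ ⟶ A) :
    insertHom t Fma.unit ≫ lam A = t := by
  rw [insertHom, Category.assoc, ← lam_naturality, ← Category.assoc, split_unit_lam,
    Category.id_comp]

theorem insertHom_alpha {A : Fma V} {Θ : List (Fma V)} (t : semF Fma.unit Θ ⟶ A)
    (X Y : Fma V) : insertHom t (X.tens Y) ≫ alpha X Y A =
      psiHom X Y Θ ≫ 𝟙 X ⊠ insertHom t Y := by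
  rw [insertHom, insertHom, Category.assoc, ← tens_id, alpha_naturality, ← Category.assoc,
    split_alpha, id_tens_comp, Category.assoc]

theorem insertHom_split {A : Fma V} {Θ : List (Fma V)} (t : semF Fma.unit Θ ⟶ A)
    (X : Fma V) (Δ : List (Fma V)) :
    insertHom t (semF X Δ) ≫ split X Δ ⊠ 𝟙 A ≫ alpha X (semF Fma.unit Δ) A =
      act (split X Δ) Θ ≫ psiHom X (semF Fma.unit Δ) Θ ≫
        𝟙 X ⊠ insertHom t (semF Fma.unit Δ) := by
  rw [← insertHom_alpha, ← Category.assoc, ← insertHom_naturality, Category.assoc]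

theorem semF_append_cons (X : Fma V) (Γ : List (Fma V)) (A : Fma V) (Δ : List (Fma V)) :
    semF X (Γ ++ A :: Δ) = semF ((semF X Γ).tens A) Δ :=
  semF_append X Γ (A :: Δ)

theorem semF_append_append (X : Fma V) (Γ Δ Λ : List (Fma V)) :
    semF X (Γ ++ (Δ ++ Λ)) = semF (semF (semF X Γ) Δ) Λ := by
  rw [semF_append, semF_append]

theorem act_append_cons {X Y : Fma V} (f : X ⟶ Y) (Γ : List (Fma V)) (A : Fma V)
    (Δ : List (Fma V)) : act f (Γ ++ A :: Δ) = eqToHom (semF_append_cons X Γ A Δ) ≫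
      act (act f Γ ⊠ 𝟙 A) Δ ≫ eqToHom (semF_append_cons Y Γ A Δ).symm :=
  act_append f Γ (A :: Δ)

theorem act_append_append {X Y : Fma V} (f : X ⟶ Y) (Γ Δ Λ : List (Fma V)) :
    act f (Γ ++ (Δ ++ Λ)) = eqToHom (semF_append_append X Γ Δ Λ) ≫
      act (act (act f Γ) Δ) Λ ≫ eqToHom (semF_append_append Y Γ Δ Λ).symm := by
  rw [act_append f Γ (Δ ++ Λ), act_append (act f Γ)]
  simp

theorem tens_eqToHom (A : Fma V) {B C : Fma V} (h : B = C) :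
    𝟙 A ⊠ eqToHom h = eqToHom (by rw [h]) := by
  subst h
  simp

theorem split_append_cons (X : Fma V) (Γ : List (Fma V)) (A : Fma V) (Δ : List (Fma V)) :
    split X (Γ ++ A :: Δ) = eqToHom (semF_append_cons X Γ A Δ) ≫
      act (split X Γ ⊠ 𝟙 A ≫ alpha X (semF Fma.unit Γ) A) Δ ≫
        psiHom X ((semF Fma.unit Γ).tens A) Δ ≫ eqToHom (by rw [semF_append_cons]) := by
  rw [act_comp, Category.assoc]
  refine (split_append X Γ (A :: Δ)).trans (congrArg (eqToHom _ ≫ ·) ?_)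
  rw [psiHom_cons]
  exact congrArg (act (split X Γ ⊠ 𝟙 A) Δ ≫ ·) (Category.assoc _ _ _)

theorem split_append_append (X : Fma V) (Γ Δ Λ : List (Fma V)) :
    split X (Γ ++ (Δ ++ Λ)) = eqToHom (semF_append_append X Γ Δ Λ) ≫
      act (act (split X Γ) Δ ≫ psiHom X (semF Fma.unit Γ) Δ) Λ ≫
        psiHom X (semF (semF Fma.unit Γ) Δ) Λ ≫ eqToHom (by rw [semF_append_append]) := by
  rw [split_append X Γ (Δ ++ Λ), act_append (split X Γ), psiHom_append, act_comp]
  simp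

/-- Replacing a passive formula `A` between `Δ₀` and `Δ₁` by a list `Θ`. -/
def insertAt {A : Fma V} {Θ : List (Fma V)} (t : semF Fma.unit Θ ⟶ A) (X : Fma V)
    (Δ₀ Δ₁ : List (Fma V)) : semF X (Δ₀ ++ (Θ ++ Δ₁)) ⟶ semF X (Δ₀ ++ A :: Δ₁) :=
  eqToHom (semF_append_append X Δ₀ Θ Δ₁) ≫ act (insertHom t (semF X Δ₀)) Δ₁ ≫
    eqToHom (semF_append_cons X Δ₀ A Δ₁).symm

theorem insertAt_nil {A : Fma V} {Θ : List (Fma V)} (t : semF Fma.unit Θ ⟶ A) (X : Fma V)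
    (Δ₁ : List (Fma V)) :
    insertAt t X [] Δ₁ = eqToHom (semF_append X Θ Δ₁) ≫ act (insertHom t X) Δ₁ :=
  congrArg (_ ≫ ·) (Category.comp_id _)

theorem insertAt_naturality {A X Y : Fma V} {Θ : List (Fma V)} (t : semF Fma.unit Θ ⟶ A)
    (f : X ⟶ Y) (Δ₀ Δ₁ : List (Fma V)) :
    act f (Δ₀ ++ (Θ ++ Δ₁)) ≫ insertAt t Y Δ₀ Δ₁ =
      insertAt t X Δ₀ Δ₁ ≫ act f (Δ₀ ++ A :: Δ₁) := by
  rw [insertAt, insertAt, act_append_append, act_append_cons]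
  simp only [Category.assoc, eqToHom_trans_assoc, eqToHom_refl, Category.id_comp]
  rw [← Category.assoc (act _ Δ₁), ← Category.assoc (act _ Δ₁), ← act_comp, ← act_comp,
    insertHom_naturality]

theorem insertAt_split_left {A : Fma V} {Θ : List (Fma V)} (t : semF Fma.unit Θ ⟶ A)
    (X : Fma V) (Δ₀ Δ₁ Λ : List (Fma V)) :
    insertAt t X Δ₀ (Δ₁ ++ Λ) = eqToHom (by simp [semF_append]) ≫ act (insertAt t X Δ₀ Δ₁) Λ ≫
      eqToHom (by simp [semF_append, semF]) := by
  rw [insertAt, insertAt, act_append, act_comp, act_comp, act_eqToHom, act_eqToHom]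
  simp

theorem insertAt_split_right {A : Fma V} {Θ : List (Fma V)} (t : semF Fma.unit Θ ⟶ A)
    (X : Fma V) (Δ₀ Δ₁ : List (Fma V)) :
    insertAt t X Δ₀ Δ₁ ≫ split X (Δ₀ ++ A :: Δ₁) =
      split X (Δ₀ ++ (Θ ++ Δ₁)) ≫ 𝟙 X ⊠ insertAt t Fma.unit Δ₀ Δ₁ := by
  rw [insertAt, insertAt, split_append_cons, split_append_append, id_tens_comp, id_tens_comp,
    tens_eqToHom, tens_eqToHom]
  simp only [Category.assoc, eqToHom_trans_assoc, eqToHom_refl, Category.id_comp]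
  rw [← Category.assoc (psiHom _ _ _), ← psiHom_naturality]
  simp only [← Category.assoc (act _ _), ← act_comp]
  rw [insertHom_split]
  simp only [Category.assoc]

theorem act_split_comp {X Y C D : Fma V} (Λ : List (Fma V)) (u : X ⟶ Y) (f : Y ⟶ C)
    (g : semF Fma.unit Λ ⟶ D) :
    split X Λ ≫ (u ≫ f) ⊠ g = act u Λ ≫ split Y Λ ≫ f ⊠ g := by
  rw [← Category.assoc (act u Λ), split_naturality, Category.assoc, ← tens_comp,
    Category.id_comp]

theorem exists_cast {S : Stp V} {Γ Γ' : List (Fma V)} {C : Fma V} (e : Γ = Γ') (f : CF S Γ C) :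
    ∃ f' : CF S Γ' C, sound f' = eqToHom (by rw [e]) ≫ sound f := by
  subst e
  exact ⟨f, by simp⟩

theorem insertAt_uf_nil {A C : Fma V} {Θ : List (Fma V)} (t : semF Fma.unit Θ ⟶ A)
    (Γ : List (Fma V)) (f : semF A Γ ⟶ C) :
    insertAt t Fma.unit [] Γ ≫ act (lam A) Γ ≫ f =
      eqToHom (semF_append _ Θ Γ) ≫ act t Γ ≫ f := by
  have h : (eqToHom (semF_append Fma.unit Θ Γ) ≫ act (insertHom t Fma.unit) Γ) ≫
      act (lam A) Γ ≫ f = eqToHom (semF_append _ Θ Γ) ≫ act t Γ ≫ f := by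
    rw [Category.assoc, ← Category.assoc (act _ Γ), ← act_comp, insertHom_unit_lam]
  exact (congrArg (· ≫ act (lam A) Γ ≫ f) (insertAt_nil t Fma.unit Γ)).trans h

theorem insertAt_uf_cons {A B C : Fma V} {Θ : List (Fma V)} (t : semF Fma.unit Θ ⟶ A)
    (Δ₀ Δ₁ : List (Fma V)) (f : semF B (Δ₀ ++ A :: Δ₁) ⟶ C) :
    insertAt t Fma.unit (B :: Δ₀) Δ₁ ≫ act (lam B) (Δ₀ ++ A :: Δ₁) ≫ f =
      act (lam B) (Δ₀ ++ (Θ ++ Δ₁)) ≫ insertAt t B Δ₀ Δ₁ ≫ f := by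
  have h : insertAt t (Fma.unit.tens B) Δ₀ Δ₁ ≫ act (lam B) (Δ₀ ++ A :: Δ₁) ≫ f =
      act (lam B) (Δ₀ ++ (Θ ++ Δ₁)) ≫ insertAt t B Δ₀ Δ₁ ≫ f := by
    rw [← Category.assoc, ← insertAt_naturality, Category.assoc]
  exact h

theorem insertAt_tr_left {A B C X : Fma V} {Θ : List (Fma V)} (t : semF Fma.unit Θ ⟶ A)
    (Δ₀ Δ₁ Λ : List (Fma V)) (f : semF X (Δ₀ ++ A :: Δ₁) ⟶ B)
    (g : semF Fma.unit Λ ⟶ C) (e₁ : semF X (Δ₀ ++ (Θ ++ (Δ₁ ++ Λ))) =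
      semF (semF X (Δ₀ ++ (Θ ++ Δ₁))) Λ)
    (e₂ : semF X (Δ₀ ++ A :: (Δ₁ ++ Λ)) = semF (semF X (Δ₀ ++ A :: Δ₁)) Λ) :
    eqToHom e₁ ≫ split _ Λ ≫ (insertAt t X Δ₀ Δ₁ ≫ f) ⊠ g =
      insertAt t X Δ₀ (Δ₁ ++ Λ) ≫ eqToHom e₂ ≫ split _ Λ ≫ f ⊠ g := by
  rw [act_split_comp, insertAt_split_left]
  simp

theorem insertAt_append {A X : Fma V} {Θ : List (Fma V)} (t : semF Fma.unit Θ ⟶ A)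
    (Γ Δ₀ Δ₁ : List (Fma V)) : insertAt t X (Γ ++ Δ₀) Δ₁ =
      eqToHom (by simp [semF_append]) ≫ insertAt t (semF X Γ) Δ₀ Δ₁ ≫
        eqToHom (by simp [semF_append]) := by
  induction Γ generalizing X with
  | nil => exact (Category.comp_id _).symm.trans (Category.id_comp _).symm
  | cons B Γ ih => exact ih (X := X.tens B)

theorem insertAt_tr_right {A B C X : Fma V} {Θ : List (Fma V)} (t : semF Fma.unit Θ ⟶ A)
    (Γ Δ₀ Δ₁ : List (Fma V)) (f : semF X Γ ⟶ B) (g : semF Fma.unit (Δ₀ ++ A :: Δ₁) ⟶ C)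
    (e₁ : semF X (Γ ++ Δ₀ ++ (Θ ++ Δ₁)) = semF (semF X Γ) (Δ₀ ++ (Θ ++ Δ₁)))
    (e₂ : semF X (Γ ++ Δ₀ ++ A :: Δ₁) = semF (semF X Γ) (Δ₀ ++ A :: Δ₁)) :
    eqToHom e₁ ≫ split _ (Δ₀ ++ (Θ ++ Δ₁)) ≫ f ⊠ (insertAt t Fma.unit Δ₀ Δ₁ ≫ g) =
      insertAt t X (Γ ++ Δ₀) Δ₁ ≫ eqToHom e₂ ≫ split _ (Δ₀ ++ A :: Δ₁) ≫ f ⊠ g := by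
  rw [insertAt_append]
  simp only [Category.assoc, eqToHom_trans_assoc, eqToHom_refl, Category.id_comp]
  rw [← Category.assoc (insertAt _ _ _ _), insertAt_split_right, Category.assoc, ← tens_comp,
    Category.id_comp]

theorem exists_replace {A : Fma V} {Θ : List (Fma V)} (t : semF Fma.unit Θ ⟶ A)
    (ht : ∀ (Γ : List (Fma V)) (C : Fma V) (g : CF (some A) Γ C), ∃ h : CF none (Θ ++ Γ) C,
      sound h = eqToHom (semF_append _ Θ Γ) ≫ act t Γ ≫ sound g)
    {S : Stp V} {Λ : List (Fma V)} {C : Fma V} (g : CF S Λ C) :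
    ∀ (Δ₀ Δ₁ : List (Fma V)) (e : Λ = Δ₀ ++ A :: Δ₁), ∃ h : CF S (Δ₀ ++ (Θ ++ Δ₁)) C,
      sound h = insertAt t (stpF S) Δ₀ Δ₁ ≫ eqToHom (by rw [e]) ≫ sound g := by
  induction g with
  | ax => simp
  | Ir => simp
  | @uf B Γ C g ih =>
    rintro (_ | ⟨B', Δ₀⟩) Δ₁ e
    · obtain ⟨rfl, rfl⟩ := List.cons.inj e
      obtain ⟨h, hh⟩ := ht _ _ g
      exact ⟨h, (hh.trans (insertAt_uf_nil t _ _).symm).trans (congrArg (insertAt t _ [] _ ≫ ·)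
        ((sound_uf g).symm.trans (Category.id_comp _).symm))⟩
    · obtain ⟨rfl, rfl⟩ := List.cons.inj e
      obtain ⟨h, hh⟩ := ih Δ₀ Δ₁ rfl
      exact ⟨h.uf, (((sound_uf h).trans (congrArg (act (lam B) _ ≫ ·) (hh.trans
        (congrArg (insertAt t _ _ _ ≫ ·) (Category.id_comp _))))).trans
          (insertAt_uf_cons t _ _ _).symm).trans (congrArg (insertAt t _ (_ :: _) _ ≫ ·)
            ((sound_uf g).symm.trans (Category.id_comp _).symm))⟩
  | Il g ih =>
    intro Δ₀ Δ₁ e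
    obtain ⟨h, hh⟩ := ih Δ₀ Δ₁ e
    exact ⟨h.Il, hh⟩
  | @tl A' B Γ C g ih =>
    intro Δ₀ Δ₁ e
    obtain ⟨h, hh⟩ := ih (B :: Δ₀) Δ₁ (by rw [e]; rfl)
    exact ⟨h.tl, hh⟩
  | @tr S Γ A' Λ B g₁ g₂ ih₁ ih₂ =>
    intro Δ₀ Δ₁ e
    rcases splitList _ _ _ _ _ e with ⟨Δ₁', rfl, rfl⟩ | ⟨Δ₀', rfl, rfl⟩
    · obtain ⟨h, hh⟩ := ih₁ Δ₀ Δ₁' rfl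
      obtain ⟨k, hk⟩ := exists_cast (by simp : _ = Δ₀ ++ (Θ ++ (Δ₁' ++ Λ))) (h.tr g₂)
      have hh' := hh.trans (congrArg (insertAt t _ _ _ ≫ ·) (Category.id_comp _))
      refine ⟨k, hk.trans ?_⟩
      rw [sound_tr, sound_tr, hh', eqToHom_trans_assoc, eqToHom_trans_assoc]
      exact insertAt_tr_left t _ _ _ _ _ _ _
    · obtain ⟨h, hh⟩ := ih₂ Δ₀' Δ₁ rfl
      obtain ⟨k, hk⟩ := exists_cast (by simp : _ = Γ ++ Δ₀' ++ (Θ ++ Δ₁)) (g₁.tr h)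
      have hh' := hh.trans (congrArg (insertAt t _ _ _ ≫ ·) (Category.id_comp _))
      refine ⟨k, hk.trans ?_⟩
      rw [sound_tr, sound_tr, hh', eqToHom_trans_assoc, eqToHom_trans_assoc]
      exact insertAt_tr_right t _ _ _ _ _ _ _

theorem insertAt_id_unit (A : Fma V) (Γ : List (Fma V)) :
    insertAt (Θ := []) (𝟙 Fma.unit) A [] Γ = act (rho A) Γ := by
  have h : insertHom (Θ := []) (𝟙 Fma.unit) A = rho A := by
    have key : (rho A ≫ 𝟙 _) ≫ 𝟙 A ⊠ 𝟙 Fma.unit = rho A := by simp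
    exact key
  refine (insertAt_nil _ _ _).trans ?_
  rw [h]
  exact Category.id_comp _

theorem insertAt_lam_comp {A B C : Fma V} (f : B ⟶ C) (Γ : List (Fma V)) :
    insertAt (Θ := [B]) (lam B ≫ f) A [] Γ = act (𝟙 A ⊠ f) Γ := by
  have h : insertHom (Θ := [B]) (lam B ≫ f) A = 𝟙 A ⊠ f := by
    have key : (rho A ⊠ 𝟙 B ≫ alpha A Fma.unit B) ≫ 𝟙 A ⊠ (lam B ≫ f) = 𝟙 A ⊠ f := by
      rw [id_tens_comp, ← Category.assoc, Category.assoc (rho A ⊠ 𝟙 B), rho_alpha_lam,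
        Category.id_comp]
    rw [← split_singleton] at key
    exact key
  refine (insertAt_nil (Θ := [B]) (lam B ≫ f) A Γ).trans ?_
  rw [h]
  exact Category.id_comp _

theorem insertAt_lam_tens (A B C : Fma V) (Γ : List (Fma V)) :
    insertAt (Θ := [B, C]) (lam B ⊠ 𝟙 C) A [] Γ = act (alpha A B C) Γ := by
  have h : insertHom (Θ := [B, C]) (lam B ⊠ 𝟙 C) A = alpha A B C := by
    have key : ((rho A ⊠ 𝟙 B) ⊠ 𝟙 C ≫ alpha A Fma.unit B ⊠ 𝟙 C ≫
        alpha A (Fma.unit.tens B) C ≫ 𝟙 _) ≫ 𝟙 A ⊠ lam B ⊠ 𝟙 C = alpha A B C := by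
      rw [Category.comp_id, Category.assoc, Category.assoc, ← alpha_naturality,
        ← Category.assoc (alpha _ _ _ ⊠ _), ← tens_comp_id, ← Category.assoc, ← tens_comp_id,
        rho_alpha_lam, tens_id, Category.id_comp]
    have hs : split A [B, C] = (rho A ⊠ 𝟙 B) ⊠ 𝟙 C ≫ alpha A Fma.unit B ⊠ 𝟙 C ≫
        alpha A (Fma.unit.tens B) C ≫ 𝟙 _ := by
      rw [split, psiHom_cons, psiHom_cons, psiHom_nil]
      rfl
    rw [← hs] at key
    exact key
  refine (insertAt_nil (Θ := [B, C]) (lam B ⊠ 𝟙 C) A Γ).trans ?_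
  rw [h]
  exact Category.id_comp _

theorem exists_sound_comp {A B : Fma V} (f : Der A B) :
    ∀ (Γ : List (Fma V)) (C : Fma V) (g : CF (some B) Γ C), ∃ h : CF (some A) Γ C,
      sound h = act (cls f) Γ ≫ sound g := by
  induction f with
  | @id A =>
    intro Γ C g
    exact ⟨g, ((congrArg (· ≫ sound g) (act_id A Γ)).trans (Category.id_comp _)).symm⟩
  | comp g f ihg ihf =>
    intro Γ C k
    obtain ⟨h, hh⟩ := ihg Γ C k
    obtain ⟨h', hh'⟩ := ihf Γ C h
    exact ⟨h', (hh'.trans (congrArg (act (cls f) Γ ≫ ·) hh)).trans ((Category.assoc _ _ _).symm.trans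
      (congrArg (· ≫ sound k) (act_comp (cls f) (cls g) Γ).symm))⟩
  | lam => exact fun Γ C g => ⟨g.uf.Il.tl, sound_uf g⟩
  | @rho A =>
    intro Γ C g
    obtain ⟨h, hh⟩ := exists_replace (Θ := []) (𝟙 Fma.unit)
      (fun Γ C g => ⟨ILinv g, (sound_ILinv g).trans
        (((congrArg (· ≫ sound g) (act_id Fma.unit Γ)).trans (Category.id_comp _)).symm.trans
          (Category.id_comp _).symm)⟩) (tensLinv g) [] Γ rfl
    refine ⟨h, hh.trans ?_⟩
    rw [sound_tensLinv]
    exact (congrArg (insertAt _ _ [] _ ≫ ·) (Category.id_comp _)).trans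
      (congrArg (· ≫ sound g) (insertAt_id_unit A Γ))
  | @alpha A B D =>
    intro Γ C g
    obtain ⟨h, hh⟩ := exists_replace (Θ := [B, D]) (lam B ⊠ 𝟙 D)
      (fun Γ C g => ⟨(tensLinv g).uf, (sound_uf _).trans
        ((congrArg (act _ _ ≫ ·) (sound_tensLinv g)).trans (Category.id_comp _).symm)⟩)
      (tensLinv g) [] Γ rfl
    refine ⟨h.tl.tl, hh.trans ?_⟩
    rw [sound_tensLinv]
    exact (congrArg (insertAt _ _ [] _ ≫ ·) (Category.id_comp _)).trans
      (congrArg (· ≫ sound g) (insertAt_lam_tens A B D Γ))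
  | @tens A₁ B₁ A₂ B₂ f₁ f₂ ih₁ ih₂ =>
    intro Γ C g
    obtain ⟨g', hg'⟩ := ih₁ _ _ (tensLinv g)
    rw [sound_tensLinv] at hg'
    obtain ⟨h, hh⟩ := exists_replace (Θ := [A₂]) (lam A₂ ≫ cls f₂)
      (fun Γ C g => by
        obtain ⟨k, hk⟩ := ih₂ _ _ g
        exact ⟨k.uf, (sound_uf k).trans (((congrArg (act _ _ ≫ ·) hk).trans
          ((Category.assoc _ _ _).symm.trans (congrArg (· ≫ sound g)
            (act_comp (lam A₂) (cls f₂) Γ).symm))).trans (Category.id_comp _).symm)⟩) g' [] Γ rfl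
    refine ⟨h.tl, hh.trans ?_⟩
    have key : act (𝟙 A₁ ⊠ cls f₂) Γ ≫ act (cls f₁ ⊠ 𝟙 _) Γ ≫ sound g =
        act (cls (f₁.tens f₂)) Γ ≫ sound g := by
      refine (Category.assoc _ _ _).symm.trans (congrArg (· ≫ sound g) ?_)
      rw [← act_comp, tens_exchange', cls_tens]
    exact ((congrArg (insertAt _ _ [] _ ≫ ·) ((Category.id_comp _).trans hg')).trans
      (congrArg (· ≫ act (cls f₁ ⊠ 𝟙 _) Γ ≫ sound g) (insertAt_lam_comp (cls f₂) Γ))).trans key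

theorem exists_sound {A C : Fma V} (f : Der A C) : ∃ h : CF (some A) [] C, sound h = cls f := by
  obtain ⟨h, hh⟩ := exists_sound_comp f [] C CF.ax
  exact ⟨h, hh.trans (Category.comp_id _)⟩

end Fsk

/-! ### Derivations with equal leaf maps are equal -/

namespace CF

/-- The monotone map on leaves induced by a cut-free derivation. -/
def leafMap {S : Stp V} {Γ : List (Fma V)} {C : Fma V} (f : CF S Γ C) : ℕ → ℕ :=
  (soundCF f).leafMap

theorem leafMap_uf {A C : Fma V} {Γ : List (Fma V)} (f : CF (some A) Γ C) (i : ℕ) :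
    f.uf.leafMap i = f.leafMap (i - 1) :=
  congrArg (soundCF f).leafMap (congrFun (Der.leafMap_actDer Der.lam Γ) i)

theorem leafMap_tr {S : Stp V} {Γ Δ : List (Fma V)} {A B : Fma V} (f : CF S Γ A)
    (g : CF none Δ B) (i : ℕ) : (f.tr g).leafMap i =
      if i < (sem S Γ).leaves then f.leafMap i
      else g.leafMap (i - (sem S Γ).leaves + 1) + A.leaves := by
  have h : (f.tr g).leafMap i = ((soundCF f).tens (soundCF g)).leafMap
      ((phiF (stpF S) Γ Δ).leafMap i) := rfl
  rw [h, Der.leafMap_phiF]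
  by_cases hi : i < (sem S Γ).leaves
  · simp only [Der.leafMap, hi, if_true]
    rfl
  · simp only [Der.leafMap, hi, if_false]
    rw [if_neg (by omega), Nat.sub_add_comm (by omega)]
    rfl

theorem leafMap_zero {S : Stp V} {Γ : List (Fma V)} {C : Fma V} (f : CF S Γ C) :
    f.leafMap 0 = 0 := (soundCF f).leafMap_zero

theorem leafMap_lt {S : Stp V} {Γ : List (Fma V)} {C : Fma V} (f : CF S Γ C) {i : ℕ}
    (h : i < (sem S Γ).leaves) : f.leafMap i < C.leaves := (soundCF f).leafMap_lt h

theorem leafMap_of_le {S : Stp V} {Γ : List (Fma V)} {C : Fma V} (f : CF S Γ C) {i : ℕ}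
    (h : (sem S Γ).leaves ≤ i) : f.leafMap i = i - (sem S Γ).leaves + C.leaves :=
  (soundCF f).leafMap_of_le h

theorem leafMap_eq_of_cfEq {S : Stp V} {Γ : List (Fma V)} {C : Fma V} {f g : CF S Γ C}
    (h : CFEq f g) : f.leafMap = g.leafMap :=
  (Fsk.cls_eq_iff.1 (Fsk.sound_eq_of_cfEq h)).leafMap_eq

theorem exists_uf_of_leafMap {A C : Fma V} {Γ Λ : List (Fma V)} :
    ∀ (f : CF none Λ C) (e : A :: Γ = Λ), f.leafMap 1 = 0 →
      ∃ f' : CF (some A) Γ C, CFEq f (e ▸ f'.uf)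
  | .uf f, e, _ => by
    obtain ⟨rfl, rfl⟩ := List.cons.inj e
    exact ⟨f, .refl⟩
  | .tr (Γ := []) (A := B) f g, e, h => by
    rw [leafMap_tr] at h
    have := B.leaves_pos
    simp [sem, semF, stpF, Fma.leaves] at h
    omega
  | .tr (Γ := B :: Γ') f g, e, h => by
    obtain ⟨rfl, rfl⟩ := List.cons.inj e
    have := A.leaves_pos
    have hlt : 1 < (sem none (A :: Γ')).leaves := by
      simp only [leaves_semF, List.map_cons, List.sum_cons, stpF, Fma.leaves]
      omega
    rw [leafMap_tr, if_pos hlt] at h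
    obtain ⟨f', hf⟩ := exists_uf_of_leafMap f rfl h
    exact ⟨f'.tr g, .trans (.trCong hf .refl) .trUf⟩

theorem eq_ax_of_var {x y : V} {Γ : List (Fma V)} :
    ∀ f : CF (some (Fma.var x)) Γ (Fma.var y), ∃ (e₁ : [] = Γ) (e₂ : x = y), f = e₁ ▸ e₂ ▸ .ax
  | .ax => ⟨rfl, rfl, rfl⟩

theorem eq_Ir_or_uf {Γ : List (Fma V)} :
    ∀ f : CF none Γ Fma.unit, (∃ e : [] = Γ, f = e ▸ .Ir) ∨
      ((∃ A' Γ', A' :: Γ' = Γ) ∧ f.leafMap 1 = 0)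
  | .Ir => .inl ⟨rfl, rfl⟩
  | .uf f => .inr ⟨⟨_, _, rfl⟩, (leafMap_uf f 1).trans f.leafMap_zero⟩

theorem exists_tr_of_var {x : V} {A B : Fma V} {Γ : List (Fma V)} :
    ∀ f : CF (some (Fma.var x)) Γ (A.tens B), ∃ (Γ₁ Δ₁ : List (Fma V))
      (f₁ : CF (some (Fma.var x)) Γ₁ A) (f₂ : CF none Δ₁ B) (e : Γ₁ ++ Δ₁ = Γ),
        f = e ▸ f₁.tr f₂
  | .tr f g => ⟨_, _, f, g, rfl, rfl⟩

theorem exists_tr_or_uf {A B : Fma V} {Γ : List (Fma V)} :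
    ∀ f : CF none Γ (A.tens B), (∃ (Γ₁ Δ₁ : List (Fma V))
      (f₁ : CF none Γ₁ A) (f₂ : CF none Δ₁ B) (e : Γ₁ ++ Δ₁ = Γ), f = e ▸ f₁.tr f₂) ∨
        ((∃ A' Γ', A' :: Γ' = Γ) ∧ f.leafMap 1 = 0)
  | .tr f g => .inl ⟨_, _, f, g, rfl, rfl⟩
  | .uf f => .inr ⟨⟨_, _, rfl⟩, (leafMap_uf f 1).trans f.leafMap_zero⟩

theorem leafMap_cast {S : Stp V} {Γ Γ' : List (Fma V)} {C : Fma V} (e : Γ = Γ')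
    (f : CF S Γ C) : (e ▸ f).leafMap = f.leafMap := by
  subst e
  rfl

theorem append_inj_of_leaves {Γ₁ Δ₁ Γ₂ Δ₂ : List (Fma V)} (e : Γ₁ ++ Δ₁ = Γ₂ ++ Δ₂)
    (h : (Γ₁.map Fma.leaves).sum = (Γ₂.map Fma.leaves).sum) : Γ₁ = Γ₂ ∧ Δ₁ = Δ₂ := by
  induction Γ₁ generalizing Γ₂ with
  | nil =>
    rcases Γ₂ with _ | ⟨B, Γ₂⟩
    · exact ⟨rfl, e⟩
    · have := B.leaves_pos
      simp only [List.map_nil, List.sum_nil, List.map_cons, List.sum_cons] at h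
      omega
  | cons A Γ₁ ih =>
    rcases Γ₂ with _ | ⟨B, Γ₂⟩
    · have := A.leaves_pos
      simp only [List.map_nil, List.sum_nil, List.map_cons, List.sum_cons] at h
      omega
    · obtain ⟨rfl, e'⟩ := List.cons.inj e
      obtain ⟨rfl, rfl⟩ := ih e' (by simpa using h)
      exact ⟨rfl, rfl⟩

theorem cfEq_tr {S : Stp V} {Γ₁ Δ₁ Γ₂ Δ₂ : List (Fma V)} {A B : Fma V} {f₁ : CF S Γ₁ A}
    {f₂ : CF none Δ₁ B} {g₁ : CF S Γ₂ A} {g₂ : CF none Δ₂ B} (e : Γ₂ ++ Δ₂ = Γ₁ ++ Δ₁)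
    (h : (f₁.tr f₂).leafMap = (g₁.tr g₂).leafMap)
    (ih₁ : ∀ g : CF S Γ₁ A, f₁.leafMap = g.leafMap → CFEq f₁ g)
    (ih₂ : ∀ g : CF none Δ₁ B, f₂.leafMap = g.leafMap → CFEq f₂ g) :
    CFEq (f₁.tr f₂) (e ▸ g₁.tr g₂) := by
  have hn : (sem S Γ₂).leaves = (sem S Γ₁).leaves := by
    have h1 := congrFun h (sem S Γ₁).leaves
    have h2 := congrFun h (sem S Γ₂).leaves
    rw [leafMap_tr, leafMap_tr, if_neg (lt_irrefl _)] at h1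
    rw [leafMap_tr, leafMap_tr, if_neg (lt_irrefl _)] at h2
    rcases lt_trichotomy (sem S Γ₁).leaves (sem S Γ₂).leaves with hlt | heq | hgt
    · rw [if_pos hlt] at h1
      have := g₁.leafMap_lt hlt
      omega
    · exact heq.symm
    · rw [if_pos hgt] at h2
      have := f₁.leafMap_lt hgt
      omega
  rw [leaves_semF, leaves_semF] at hn
  obtain ⟨rfl, rfl⟩ := append_inj_of_leaves e (by omega)
  refine .trCong (ih₁ _ (funext fun i => ?_)) (ih₂ _ (funext fun i => ?_))
  · by_cases hi : i < (sem S Γ₂).leaves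
    · have := congrFun h i
      rwa [leafMap_tr, leafMap_tr, if_pos hi, if_pos hi] at this
    · rw [f₁.leafMap_of_le (by omega), g₁.leafMap_of_le (by omega)]
  · rcases i with _ | i
    · rw [leafMap_zero, leafMap_zero]
    · have := congrFun h ((sem S Γ₂).leaves + i)
      rw [leafMap_tr, leafMap_tr, if_neg (by omega), if_neg (by omega)] at this
      simpa using this

/-- A size for stoups that makes the left rules decreasing. -/
def stoupSize : Stp V → ℕ
  | none => 0
  | some A => 3 * A.leaves - 2

/-- A size for contexts that makes the left rules decreasing. -/
def contextSize (Γ : List (Fma V)) : ℕ := (Γ.map fun A => 3 * A.leaves - 1).sum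

theorem contextSize_cons (A : Fma V) (Γ : List (Fma V)) :
    contextSize (A :: Γ) = 3 * A.leaves - 1 + contextSize Γ := rfl

theorem contextSize_append (Γ Δ : List (Fma V)) :
    contextSize (Γ ++ Δ) = contextSize Γ + contextSize Δ := by
  simp [contextSize]

theorem cfEq_of_leafMap_eq {S : Stp V} {Γ : List (Fma V)} {C : Fma V} (f g : CF S Γ C)
    (h : f.leafMap = g.leafMap) : CFEq f g := by
  induction hn : stoupSize S + contextSize Γ + C.leaves using Nat.strong_induction_on
    generalizing S Γ C with
  | _ n ih =>
  subst hn
  match S, f, g, h with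
  | some (.var x), f, g, h =>
    match C, f, g, h with
    | .var _, f, g, _ =>
      obtain ⟨rfl, rfl, rfl⟩ := eq_ax_of_var f
      obtain ⟨_, _, rfl⟩ := eq_ax_of_var g
      exact .refl
    | .tens A B, f, g, h =>
      obtain ⟨Γ₁, Δ₁, f₁, f₂, rfl, rfl⟩ := exists_tr_of_var f
      obtain ⟨Γ₂, Δ₂, g₁, g₂, e, rfl⟩ := exists_tr_of_var g
      rw [leafMap_cast] at h
      have := A.leaves_pos
      have := B.leaves_pos
      exact cfEq_tr e h
        (fun g hg => ih _ (by simp only [contextSize_append, Fma.leaves]; omega) _ _ hg rfl)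
        (fun g hg => ih _ (by simp only [contextSize_append, Fma.leaves, stoupSize]; omega)
          _ _ hg rfl)
  | some .unit, f, g, h =>
    have hf := cfEq_Il_ILinv f
    have hg := cfEq_Il_ILinv g
    rw [← leafMap_eq_of_cfEq hf, ← leafMap_eq_of_cfEq hg] at h
    exact hf.symm.trans (.trans (.IlCong (ih _ (by simp [stoupSize, Fma.leaves]) _ _ h rfl)) hg)
  | some (.tens A B), f, g, h =>
    have hf := cfEq_tl_tensLinv f
    have hg := cfEq_tl_tensLinv g
    rw [← leafMap_eq_of_cfEq hf, ← leafMap_eq_of_cfEq hg] at h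
    have := A.leaves_pos
    have := B.leaves_pos
    exact hf.symm.trans (.trans (.tlCong (ih _ (by
      simp only [contextSize_cons, Fma.leaves, stoupSize]; omega) _ _ h rfl)) hg)
  | none, f, g, h =>
    by_cases hu : (∃ A Γ', A :: Γ' = Γ) ∧ f.leafMap 1 = 0
    · obtain ⟨⟨A, Γ, rfl⟩, hu⟩ := hu
      obtain ⟨f', hf⟩ := exists_uf_of_leafMap f rfl hu
      obtain ⟨g', hg⟩ := exists_uf_of_leafMap g rfl (by rw [← h, hu])
      rw [leafMap_eq_of_cfEq hf, leafMap_eq_of_cfEq hg] at h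
      have := A.leaves_pos
      refine hf.trans (.trans (.ufCong (ih _ (by
        simp only [contextSize_cons, stoupSize]; omega) _ _ (funext fun i => ?_) rfl)) hg.symm)
      have := congrFun h (i + 1)
      exact (leafMap_uf f' (i + 1)).symm.trans (this.trans (leafMap_uf g' (i + 1)))
    · have hu' : ¬((∃ A Γ', A :: Γ' = Γ) ∧ g.leafMap 1 = 0) := by rwa [← h]
      match C, f, g, h, hu, hu' with
      | .var _, .uf f, g, h, hu, _ =>
        exact absurd ⟨⟨_, _, rfl⟩, (leafMap_uf f 1).trans f.leafMap_zero⟩ hu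
      | .unit, f, g, _, hu, hu' =>
        obtain ⟨rfl, rfl⟩ := (eq_Ir_or_uf f).resolve_right hu
        obtain ⟨_, rfl⟩ := (eq_Ir_or_uf g).resolve_right hu'
        exact .refl
      | .tens A B, f, g, h, hu, hu' =>
        obtain ⟨Γ₁, Δ₁, f₁, f₂, rfl, rfl⟩ := (exists_tr_or_uf f).resolve_right hu
        obtain ⟨Γ₂, Δ₂, g₁, g₂, e, rfl⟩ := (exists_tr_or_uf g).resolve_right hu'
        rw [leafMap_cast] at h
        have := A.leaves_pos
        have := B.leaves_pos
        exact cfEq_tr e h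
          (fun g hg => ih _ (by simp only [contextSize_append, Fma.leaves]; omega) _ _ hg rfl)
          (fun g hg => ih _ (by simp only [contextSize_append, Fma.leaves, stoupSize]; omega)
            _ _ hg rfl)

end CF

/-! ### Leaf maps of admissible rules -/

namespace CF

theorem leafMap_mpr {S : Stp V} {Γ Γ' : List (Fma V)} {C : Fma V} (e : Γ' = Γ)
    (h : CF S Γ C = CF S Γ' C) (f : CF S Γ' C) : (h.mpr f).leafMap = f.leafMap := by
  subst e
  rfl

theorem leafMap_ccutCF_uf {Γ Λ Δ₁ : List (Fma V)} {A B B' C : Fma V} (Δ₀ : List (Fma V))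
    (f : CF none Γ A) (g : CF (some B) Λ C) (h : B :: Λ = B' :: Δ₀ ++ A :: Δ₁)
    (h' : Λ = Δ₀ ++ A :: Δ₁) (i : ℕ) :
    (ccutCF (B' :: Δ₀) f g.uf h).leafMap i = (ccutCF Δ₀ f g h').leafMap (i - 1) := by
  obtain ⟨rfl, _⟩ := List.cons.inj h
  subst h'
  rw [ccutCF]
  exact leafMap_uf _ i

mutual
theorem leafMap_scutCF : {V : Type} → {S : Stp V} → {Γ Δ : List (Fma V)} → {A C : Fma V} →
    (f : CF S Γ A) → (g : CF (some A) Δ C) → ∀ i,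
      (scutCF f g).leafMap i = g.leafMap (f.leafMap i)
  | _, _, _, _, _, _, .ax, g, i => by
    rw [scutCF]
    rfl
  | _, _, _, _, _, _, .uf f, g, i => by
    rw [scutCF]
    exact (leafMap_uf _ i).trans ((leafMap_scutCF f g (i - 1)).trans
      (congrArg g.leafMap (leafMap_uf f i).symm))
  | _, _, _, _, _, _, .Il f, g, i => by
    rw [scutCF]
    exact leafMap_scutCF f g i
  | _, _, _, _, _, _, .tl f, g, i => by
    rw [scutCF]
    exact leafMap_scutCF f g i
  | _, _, _, _, _, _, .Ir, .ax, i => by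
    rw [scutCF]
    rfl
  | _, _, _, _, _, _, .Ir, .Il g, i => by
    rw [scutCF]
    rfl
  | _, _, _, _, _, _, .Ir, .tr g₁ g₂, i => by
    rw [scutCF]
    refine (leafMap_tr _ _ i).trans (Eq.trans ?_ (leafMap_tr g₁ g₂ i).symm)
    rw [leafMap_scutCF .Ir g₁ i]
    rfl
  | _, _, _, _, _, _, .tr f₁ f₂, .ax, i => by
    rw [scutCF, leafMap_mpr (List.append_nil _).symm]
    rfl
  | _, _, _, _, _, _, .tr (Γ := Γ₁) f₁ f₂, .tl g, i => by
    rw [scutCF, leafMap_ccutCF Γ₁ f₂ (scutCF f₁ g) rfl i, leafMap_scutCF f₁ g, leafMap_tr]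
    refine congrArg g.leafMap ?_
    split_ifs with h
    · rfl
    · rw [f₁.leafMap_of_le (by omega)]
      omega
  | _, _, _, _, _, _, .tr f₁ f₂, .tr g₁ g₂, i => by
    rw [scutCF, leafMap_mpr (List.append_assoc _ _ _), leafMap_tr, leafMap_tr,
      leafMap_scutCF (.tr f₁ f₂) g₁ i]
    have h₁ := (f₁.tr f₂).leafMap_lt (i := i)
    have h₂ := (f₁.tr f₂).leafMap_of_le (i := i)
    simp only [leaves_semF, stpF, List.map_append, List.sum_append] at h₁ h₂ ⊢
    grind
  termination_by V S Γ Δ A C f g => (sizeOf A, sizeOf g, sizeOf f)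
  decreasing_by
    all_goals simp_wf
    all_goals (first
      | (apply Prod.Lex.left; first | omega | (simp; omega))
      | (apply Prod.Lex.right; first
          | (apply Prod.Lex.left; first | omega | (simp; omega))
          | (apply Prod.Lex.right; omega)))

theorem leafMap_ccutCF : {V : Type} → {S : Stp V} → {Γ Λ Δ₁ : List (Fma V)} → {A C : Fma V} →
    (Δ₀ : List (Fma V)) → (f : CF none Γ A) → (g : CF S Λ C) → (h : Λ = Δ₀ ++ A :: Δ₁) → ∀ i,
      (ccutCF Δ₀ f g h).leafMap i = g.leafMap (if i < (sem S Δ₀).leaves then i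
        else f.leafMap (i - (sem S Δ₀).leaves + 1) + (sem S Δ₀).leaves)
  | _, _, _, _, _, _, _, _, _, .ax, h, _ => by simp at h
  | _, _, _, _, _, _, _, _, _, .Ir, h, _ => by simp at h
  | _, _, _, _, _, _, _, [], f, .uf g, rfl, i => by
    rw [ccutCF]
    refine (leafMap_scutCF f g i).trans (Eq.trans ?_ (leafMap_uf g _).symm)
    refine congrArg g.leafMap ?_
    simp only [semF, stpF, Fma.leaves]
    rcases i with _ | i
    · exact f.leafMap_zero
    · simp
  | _, _, _, _, _, _, _, B :: Δ₀, f, .uf (A := B') g, h, i => by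
    obtain ⟨h₁, h₂⟩ := List.cons.inj h
    subst h₁
    refine (leafMap_ccutCF_uf Δ₀ f g h h₂ i).trans ((leafMap_ccutCF Δ₀ f g h₂ (i - 1)).trans
      (Eq.trans ?_ (leafMap_uf g _).symm))
    refine congrArg g.leafMap ?_
    simp only [leaves_semF, stpF, Fma.leaves, List.map_cons, List.sum_cons]
    have := B'.leaves_pos
    rcases i with _ | i
    · rw [if_pos (by omega), if_pos (by omega)]
    · simp only [Nat.add_sub_cancel, Nat.add_comm 1, Nat.add_lt_add_iff_right,
        Nat.add_sub_add_right]
      split_ifs <;> omega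
  | _, _, _, _, _, _, _, Δ₀, f, .Il g, h, i => by
    rw [ccutCF]
    exact leafMap_ccutCF Δ₀ f g h i
  | _, _, _, _, _, _, _, Δ₀, f, .tl (B := B) g, h, i => by
    rw [ccutCF]
    exact leafMap_ccutCF (B :: Δ₀) f g (by simp [h]) i
  | _, S, _, _, Δ₁, A, _, Δ₀, f, .tr (Γ := Λ₁) (Δ := Λ₂) g₁ g₂, h, i => by
    rw [ccutCF]
    rcases splitList Λ₁ Λ₂ Δ₀ Δ₁ A h with ⟨Δ₁', h₁, h₂⟩ | ⟨Δ₀', h₁, h₂⟩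
    · subst h₂
      refine (congrFun (leafMap_mpr (by simp) _ _) i).trans ?_
      rw [leafMap_tr, leafMap_tr, leafMap_ccutCF Δ₀ f g₁ h₁ i]
      have b₁ := f.leafMap_lt (i := i - (sem S Δ₀).leaves + 1)
      have b₂ := f.leafMap_of_le (i := i - (sem S Δ₀).leaves + 1)
      subst h₁
      simp only [leaves_semF, stpF, List.map_append, List.sum_append, List.map_cons,
        List.sum_cons, Fma.leaves] at b₁ b₂ ⊢
      grind
    · subst h₂
      refine (congrFun (leafMap_mpr (by simp) _ _) i).trans ?_
      rw [leafMap_tr, leafMap_tr, leafMap_ccutCF Δ₀' f g₂ h₁]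
      simp only [leaves_semF, stpF, List.map_append, List.sum_append, Fma.leaves]
      grind
  termination_by V S Γ Λ Δ₁ A C Δ₀ f g h => (sizeOf A, sizeOf g, sizeOf f)
  decreasing_by
    all_goals simp_wf
    all_goals (first
      | (apply Prod.Lex.left; first | omega | (simp; omega))
      | (apply Prod.Lex.right; apply Prod.Lex.left; first | omega | (simp; omega)))
end

theorem leafMap_cmpltCF {A C : Fma V} (f : Der A C) : (cmpltCF f).leafMap = f.leafMap := by
  induction f with
  | id => rfl
  | comp g f ihg ihf =>
    funext i
    rw [cmpltCF, leafMap_scutCF, ihf, ihg, Der.leafMap]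
  | tens f g ihf ihg =>
    funext i
    refine (leafMap_tr (cmpltCF f) (cmpltCF g).uf i).trans ?_
    rw [leafMap_uf, ihf, ihg]
    rfl
  | lam =>
    funext i
    exact leafMap_uf _ i
  | @rho A =>
    funext i
    refine (leafMap_tr .ax .Ir i).trans ?_
    have : (if i < A.leaves then i else i - A.leaves + 1 + A.leaves) =
        if i < A.leaves then i else i + 1 := by
      split_ifs <;> omega
    exact this
  | @alpha A B D =>
    funext i
    refine (leafMap_tr .ax (.uf (.tr .ax (.uf .ax))) i).trans ?_
    rw [leafMap_uf, leafMap_tr, leafMap_uf]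
    have : (if i < A.leaves then i else (if i - A.leaves + 1 - 1 < B.leaves then
      i - A.leaves + 1 - 1 else i - A.leaves + 1 - 1 - B.leaves + 1 - 1 + B.leaves) + A.leaves) =
        i := by
      split_ifs <;> omega
    exact this

end CF

theorem sound_otLinvF {A C : Fma V} {Δ : List (Fma V)} (Γ : List (Fma V))
    (f : CF (some (semF A Γ)) Δ C) :
    HEq (Fsk.sound (otLinvF Γ f)) (Fsk.sound f) ∧ (otLinvF Γ f).leafMap = f.leafMap := by
  induction Γ generalizing A with
  | nil => exact ⟨.rfl, rfl⟩
  | cons B Γ ih =>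
    have h := cfEq_tl_tensLinv (otLinvF (A := A.tens B) Γ f)
    exact ⟨(heq_of_eq (Fsk.sound_tensLinv _)).trans (ih (A := A.tens B) f).1,
      (CF.leafMap_eq_of_cfEq h).trans (ih (A := A.tens B) f).2⟩

theorem sound_otLinvstar {C : Fma V} {Δ : List (Fma V)} (S : Stp V) (Γ : List (Fma V))
    (f : CF (some (sem S Γ)) Δ C) : HEq (Fsk.sound (otLinvstar S Γ f)) (Fsk.sound f) ∧
      (otLinvstar S Γ f).leafMap = f.leafMap := by
  match S with
  | some _ => exact sound_otLinvF Γ f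
  | none =>
    have h := cfEq_Il_ILinv (otLinvF (A := Fma.unit) Γ f)
    exact ⟨(heq_of_eq (Fsk.sound_ILinv _)).trans (sound_otLinvF (A := Fma.unit) Γ f).1,
      (CF.leafMap_eq_of_cfEq h).trans (sound_otLinvF (A := Fma.unit) Γ f).2⟩

theorem sound_mp {S : Stp V} {Γ Γ' : List (Fma V)} {C : Fma V} (e : Γ' = Γ)
    (h : CF S Γ' C = CF S Γ C) (f : CF S Γ' C) :
    HEq (Fsk.sound (h.mp f)) (Fsk.sound f) ∧ (h.mp f).leafMap = f.leafMap := by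
  subst e
  exact ⟨.rfl, rfl⟩

theorem sound_strcmplt {S : Stp V} {Γ : List (Fma V)} {C : Fma V} (f : Der (sem S Γ) C) :
    Fsk.sound (strcmplt f) = Fsk.sound (cmpltCF f) ∧ (strcmplt f).leafMap = f.leafMap := by
  have h₁ := sound_mp (List.append_nil Γ) (by rw [List.append_nil])
    (otLinvstar S Γ (Δ := []) (cmpltCF f))
  have h₂ := sound_otLinvstar S Γ (cmpltCF f)
  exact ⟨eq_of_heq (h₁.1.trans h₂.1), (h₁.2.trans h₂.2).trans (CF.leafMap_cmpltCF f)⟩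

theorem sound_cmpltCF {A C : Fma V} (f : Der A C) : Fsk.sound (cmpltCF f) = Fsk.cls f := by
  obtain ⟨h, hh⟩ := Fsk.exists_sound f
  rw [← hh]
  refine Fsk.sound_eq_of_cfEq (CF.cfEq_of_leafMap_eq _ _ ?_)
  rw [CF.leafMap_cmpltCF]
  exact (Fsk.cls_eq_iff.1 hh).leafMap_eq.symm

end

/-- `sound` and `strcmplt = ⊗L*⁻¹ ∘ cmplt` are mutually inverse translations between
cut-free sequent derivations of `S ∣ Γ ⟶ C` up to `◦≐` and categorical derivations
`⟦S ∣ Γ⟧ ⟶ C` up to `≐`; in particular derivations of `A ∣ – ⟶ C` up to `◦≐`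
correspond bijectively to maps `A ⟶ C` in the free skew monoidal category. -/
theorem statement12 (V : Type) :
    (∀ (S : Stp V) (Γ : List (Fma V)) (C : Fma V) (f : Der (sem S Γ) C),
      DerEq (soundCF (strcmplt f)) f) ∧
    (∀ (S : Stp V) (Γ : List (Fma V)) (C : Fma V) (f : CF S Γ C),
      CFEq (strcmplt (soundCF f)) f) ∧
    (∀ (A C : Fma V) (f : Der A C), DerEq (soundCF (cmpltCF f)) f) ∧
    (∀ (A C : Fma V) (f : CF (some A) [] C), CFEq (cmpltCF (soundCF f)) f) := by
  refine ⟨fun S Γ C f => ?_, fun S Γ C f => ?_, fun A C f => ?_, fun A C f => ?_⟩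
  · exact Fsk.cls_eq_iff.1 ((sound_strcmplt f).1.trans (sound_cmpltCF f))
  · exact CF.cfEq_of_leafMap_eq _ _ (sound_strcmplt (soundCF f)).2
  · exact Fsk.cls_eq_iff.1 (sound_cmpltCF f)
  · exact CF.cfEq_of_leafMap_eq _ _ (CF.leafMap_cmpltCF (soundCF f))
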